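/- arXiv:1704.07067 — 7 statements merged into one kernel-verified Lean document; each statement's English description precedes it below -/
import Mathlib

section
/- If x is a reroutable s-t-flow, then the flow (1/2)x (which assigns value x(P)/2 to every path P) is a strictly reroutable s-t-flow. -/
open scoped BigOperators

variable {V A : Type}

/-- `IsWalk tl hd v w L`: the list of arcs `L` forms a walk from `v` to `w`
in the digraph whose arcs `a` go from `tl a` to `hd a`. -/
def IsWalk (tl hd : A → V) : V → V → List A → Prop
  | v, w, [] => v = w
  | v, w, a :: L => tl a = v ∧ IsWalk tl hd (hd a) w L

/-- A simple path from `v` to `w`: a walk visiting no vertex twice. -/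
def IsPath (tl hd : A → V) (v w : V) (L : List A) : Prop :=
  IsWalk tl hd v w L ∧ (v :: L.map hd).Nodup

/-- `Before L b a`: the list `L` traverses `b` (strictly) before `a`. -/
def Before (L : List A) (b a : A) : Prop :=
  ∃ l₁ l₂ l₃ : List A, L = l₁ ++ b :: (l₂ ++ a :: l₃)

/-- Sum of a path-flow over a set of paths. -/
noncomputable def sumOver (x : List A → ℝ) (S : Set (List A)) : ℝ :=
  ∑ᶠ P ∈ S, x P

/-- Flow value `x(a)` on an arc `a`: total flow on `s`-`t`-paths through `a`. -/
noncomputable def arcFlow (tl hd : A → V) (s t : V) (x : List A → ℝ) (a : A) : ℝ :=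
  sumOver x {P | IsPath tl hd s t P ∧ a ∈ P}

/-- The value of a flow: total flow on all `s`-`t`-paths. -/
noncomputable def flowVal (tl hd : A → V) (s t : V) (x : List A → ℝ) : ℝ :=
  sumOver x {P | IsPath tl hd s t P}

/-- An `s`-`t`-(path-)flow: nonnegative, supported on simple `s`-`t`-paths,
respecting the arc capacities `u`. -/
def IsFlow (tl hd : A → V) (s t : V) (u : A → ℝ) (x : List A → ℝ) : Prop :=
  (∀ P, 0 ≤ x P) ∧ (∀ P, ¬ IsPath tl hd s t P → x P = 0) ∧
    ∀ a : A, arcFlow tl hd s t x a ≤ u a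

/-- Available capacity `ū_{x,b}(a)` of arc `a` after failure of arc `b`:
`u(a)` minus the flow on paths through `a` that do not traverse `b` before `a`. -/
noncomputable def availCap (tl hd : A → V) (s t : V) (u : A → ℝ) (x : List A → ℝ)
    (b a : A) : ℝ :=
  u a - sumOver x {P | IsPath tl hd s t P ∧ a ∈ P ∧ ¬ Before P b a}

/-- Arc flow of a rerouting flow `y` for failing arc `b`: `y` lives on
`tl b`-`t`-paths avoiding `b`. -/
noncomputable def reArcFlow (tl hd : A → V) (t : V) (b : A) (y : List A → ℝ) (a : A) : ℝ :=
  sumOver y {Q | IsPath tl hd (tl b) t Q ∧ b ∉ Q ∧ a ∈ Q}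

/-- Value of a rerouting flow `y` for failing arc `b`. -/
noncomputable def reVal (tl hd : A → V) (t : V) (b : A) (y : List A → ℝ) : ℝ :=
  sumOver y {Q | IsPath tl hd (tl b) t Q ∧ b ∉ Q}

/-- `y` is a rerouting of `x` for the failing arc `b`: a `tl b`-`t`-flow of value
`x(b)` in `(V, A ∖ {b})` with capacities `ū_{x,b}`. -/
def IsRerouting (tl hd : A → V) (s t : V) (u : A → ℝ) (x : List A → ℝ) (b : A)
    (y : List A → ℝ) : Prop :=
  (∀ Q, 0 ≤ y Q) ∧
  (∀ Q, ¬ (IsPath tl hd (tl b) t Q ∧ b ∉ Q) → y Q = 0) ∧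
  (∀ a : A, a ≠ b → reArcFlow tl hd t b y a ≤ availCap tl hd s t u x b a) ∧
  reVal tl hd t b y = arcFlow tl hd s t x b

/-- `y` is a strict rerouting of `x` for the failing arc `b`: a `tl b`-`t`-flow
of value `x(b)` in `(V, A ∖ {b})` with `y(a) ≤ u(a) - x(a)` for all `a ≠ b`. -/
def IsStrictRerouting (tl hd : A → V) (s t : V) (u : A → ℝ) (x : List A → ℝ) (b : A)
    (y : List A → ℝ) : Prop :=
  (∀ Q, 0 ≤ y Q) ∧
  (∀ Q, ¬ (IsPath tl hd (tl b) t Q ∧ b ∉ Q) → y Q = 0) ∧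
  (∀ a : A, a ≠ b → reArcFlow tl hd t b y a ≤ u a - arcFlow tl hd s t x a) ∧
  reVal tl hd t b y = arcFlow tl hd s t x b

/-- `x` is reroutable: a rerouting exists for every failing arc. -/
def Reroutable (tl hd : A → V) (s t : V) (u : A → ℝ) (x : List A → ℝ) : Prop :=
  ∀ b : A, ∃ y : List A → ℝ, IsRerouting tl hd s t u x b y

/-- `x` is strictly reroutable: a strict rerouting exists for every failing arc. -/
def StrictlyReroutable (tl hd : A → V) (s t : V) (u : A → ℝ) (x : List A → ℝ) : Prop :=
  ∀ b : A, ∃ y : List A → ℝ, IsStrictRerouting tl hd s t u x b y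

theorem sumOver_half {A : Type} (x : List A → ℝ) (S : Set (List A)) :
    sumOver (fun P => x P / 2) S = sumOver x S / 2 := by
  have h1 : ∀ P, x P / 2 = (2⁻¹ : ℝ) • x P := fun P => by rw [smul_eq_mul]; ring
  have h2 : sumOver x S / 2 = (2⁻¹ : ℝ) • sumOver x S := by rw [smul_eq_mul]; ring
  rw [h2]
  unfold sumOver
  simp only [h1]
  rw [smul_finsum]
  refine finsum_congr fun P => ?_
  rw [smul_finsum]

theorem finite_paths {V A : Type} [Fintype A] [DecidableEq A] (tl hd : A → V) (s t : V) :
    {P | IsPath tl hd s t P}.Finite := by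
  refine (List.finite_length_le A (Fintype.card A)).subset fun P hP => ?_
  have h : P.Nodup := List.Nodup.of_map hd (List.nodup_cons.1 hP.2).2
  exact h.length_le_card

theorem half_of_reroutable_is_strictlyReroutable
    {V A : Type} [Fintype V] [DecidableEq V] [Fintype A] [DecidableEq A]
    (tl hd : A → V) (s t : V) (u : A → ℝ) (hu : ∀ a, 0 ≤ u a)
    (x : List A → ℝ) (hx : IsFlow tl hd s t u x)
    (hrf : Reroutable tl hd s t u x) :
    IsFlow tl hd s t u (fun P => x P / 2) ∧
      StrictlyReroutable tl hd s t u (fun P => x P / 2) := by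

  obtain ⟨h0, h1, h2⟩ := hx
  have hpos : ∀ S, 0 ≤ sumOver x S := fun S =>
    finsum_nonneg fun P => finsum_nonneg fun _ => h0 P
  refine ⟨⟨fun P => by have := h0 P; positivity, fun P hP => by simp [h1 P hP], fun a => ?_⟩, ?_⟩
  · have := h2 a
    have h3 := hu a
    unfold arcFlow at *
    rw [sumOver_half]
    linarith
  · intro b
    obtain ⟨y, y0, y1, y2, y3⟩ := hrf b
    refine ⟨fun Q => y Q / 2, fun Q => by have := y0 Q; positivity,
      fun Q hQ => by simp [y1 Q hQ], fun a ha => ?_, ?_⟩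
    · have e2 := y2 a ha
      have e := h2 a
      have hsplit : sumOver x {P | IsPath tl hd s t P ∧ a ∈ P} =
          sumOver x {P | IsPath tl hd s t P ∧ a ∈ P ∧ ¬ Before P b a} +
          sumOver x {P | IsPath tl hd s t P ∧ a ∈ P ∧ Before P b a} := by
        unfold sumOver
        rw [← finsum_mem_union]
        · refine finsum_mem_congr ?_ fun _ _ => rfl
          ext P
          simp only [Set.mem_union, Set.mem_ofPred_eq]
          tauto
        · rw [Set.disjoint_left]
          intro P hP hP'
          exact hP.2.2 hP'.2.2
        · exact (finite_paths tl hd s t).subset fun P hP => hP.1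
        · exact (finite_paths tl hd s t).subset fun P hP => hP.1
      have p := hpos {P | IsPath tl hd s t P ∧ a ∈ P ∧ ¬ Before P b a}
      unfold arcFlow at *
      unfold reArcFlow availCap at *
      rw [sumOver_half, sumOver_half]
      linarith
    · unfold reVal arcFlow at *
      rw [sumOver_half, sumOver_half, y3]
end

section
/- For every reroutable s-t-flow x and every R-cut (R, (C_a)_{a∈R}), the value of x is at most the capacity of the R-cut: val(x) ≤ cap(R,C). -/
open scoped BigOperators

variable {V A : Type}

/-- A `v`-`w`-cut: a (finite) set of arcs meeting every simple `v`-`w`-path. -/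
def IsCut (tl hd : A → V) (v w : V) (C : Finset A) : Prop :=
  ∀ L : List A, IsPath tl hd v w L → ∃ a ∈ C, a ∈ L

/-- A `v`-`w`-cut in the digraph obtained by deleting the arcs in `Del`. -/
def IsCutIn (tl hd : A → V) (v w : V) (Del : Finset A) (S : Finset A) : Prop :=
  Disjoint S Del ∧
    ∀ L : List A, IsPath tl hd v w L → (∀ a ∈ L, a ∉ Del) → ∃ a ∈ S, a ∈ L

/-- Minimum capacity of a `v`-`w`-cut in the digraph with the arcs of `Del` deleted. -/
noncomputable def minCutCap (tl hd : A → V) (v w : V) (u : A → ℝ) (Del : Finset A) : ℝ :=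
  sInf {c : ℝ | ∃ S : Finset A, IsCutIn tl hd v w Del S ∧ c = ∑ a ∈ S, u a}

/-- An R-cut: a set `R` of arcs with, for each `a ∈ R`, a `tl a`-`t`-cut `C a` containing `a`. -/
def IsRCut (tl hd : A → V) (t : V) (R : Finset A) (C : A → Finset A) : Prop :=
  ∀ a ∈ R, a ∈ C a ∧ IsCut tl hd (tl a) t (C a)

/-- Capacity of an R-cut: `φ(R,C) + ∑_{a ∈ R} u(C_a ∖ {a})`, where `φ(R,C)` is the
minimum capacity of an `s`-`t`-cut after deleting all arcs of `⋃_{a ∈ R} C_a`. -/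
noncomputable def rcutCap [DecidableEq A] (tl hd : A → V) (s t : V) (u : A → ℝ)
    (R : Finset A) (C : A → Finset A) : ℝ :=
  minCutCap tl hd s t u (R.biUnion C) + ∑ a ∈ R, ∑ a' ∈ (C a).erase a, u a'

theorem isPath_finite {V A : Type} [Fintype A] (tl hd : A → V) (v w : V) :
    {P | IsPath tl hd v w P}.Finite := by
  classical
  refine (List.finite_length_le A (Fintype.card A)).subset ?_
  intro P hP
  have h : P.Nodup := List.Nodup.of_map hd (List.nodup_cons.1 hP.2).2
  exact h.length_le_card

theorem sumOver_union_le {A : Type} (x : List A → ℝ) (hx : ∀ P, 0 ≤ x P)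
    {S T U : Set (List A)} (hT : T.Finite) (hU : U.Finite) (h : S ⊆ T ∪ U) :
    sumOver x S ≤ sumOver x T + sumOver x U := by
  classical
  have hS : S.Finite := (hT.union hU).subset h
  unfold sumOver
  rw [finsum_mem_eq_finite_toFinset_sum _ hS, finsum_mem_eq_finite_toFinset_sum _ hT,
    finsum_mem_eq_finite_toFinset_sum _ hU, ← Finset.sum_union_inter]
  have h1 : ∑ P ∈ hS.toFinset, x P ≤ ∑ P ∈ hT.toFinset ∪ hU.toFinset, x P := by
    apply Finset.sum_le_sum_of_subset_of_nonneg
    · intro P hP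
      simpa using h (by simpa using hP)
    · intro P _ _
      exact hx P
  have h2 : 0 ≤ ∑ P ∈ hT.toFinset ∩ hU.toFinset, x P := Finset.sum_nonneg fun P _ => hx P
  linarith

theorem sumOver_biUnion_le {A ι : Type} (x : List A → ℝ) (hx : ∀ P, 0 ≤ x P)
    (I : Finset ι) (T : ι → Set (List A)) (hT : ∀ i, (T i).Finite) :
    ∀ S : Set (List A), (∀ P ∈ S, ∃ i ∈ I, P ∈ T i) →
    sumOver x S ≤ ∑ i ∈ I, sumOver x (T i) := by
  classical
  induction I using Finset.induction_on with
  | empty =>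
    intro S h
    have : S = ∅ := by
      ext P
      simpa using fun hP => by simpa using h P hP
    simp [this, sumOver]
  | insert i I hi ih =>
    intro S h
    rw [Finset.sum_insert hi]
    have h1 := ih {P | ∃ i ∈ I, P ∈ T i} (fun P hP => hP)
    have hf : {P | ∃ i ∈ I, P ∈ T i}.Finite := by
      refine (I.finite_toSet.biUnion fun i _ => hT i).subset ?_
      intro P hP
      simpa using hP
    have h2 := sumOver_union_le x hx (S := S) (hT i) hf (by
      intro P hP
      obtain ⟨j, hj, hPj⟩ := h P hP
      rcases Finset.mem_insert.1 hj with rfl | hj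
      · exact Or.inl hPj
      · exact Or.inr ⟨j, hj, hPj⟩)
    linarith

/-- For every reroutable s-t-flow `x` and every R-cut `(R, C)`,
`val(x) ≤ cap(R, C)`. -/
theorem reroutable_val_le_rcutCap
    {V A : Type} [Fintype V] [DecidableEq V] [Fintype A] [DecidableEq A]
    (tl hd : A → V) (s t : V) (hst : s ≠ t) (u : A → ℝ) (hu : ∀ a, 0 ≤ u a)
    (x : List A → ℝ) (hx : IsFlow tl hd s t u x)
    (hrf : Reroutable tl hd s t u x)
    (R : Finset A) (C : A → Finset A) (hRC : IsRCut tl hd t R C) :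
    flowVal tl hd s t x ≤ rcutCap tl hd s t u R C := by
  have hfin : ∀ v w (q : List A → Prop), {P | IsPath tl hd v w P ∧ q P}.Finite :=
    fun v w q => (isPath_finite tl hd v w).subset fun P hP => hP.1
  obtain ⟨hx0, hxs, hxc⟩ := hx
  have key : ∀ a ∈ R, sumOver x {P | IsPath tl hd s t P ∧ ∃ b ∈ C a, b ∈ P}
      ≤ ∑ a' ∈ (C a).erase a, u a' := by
    intro a ha
    obtain ⟨haC, hcut⟩ := hRC a ha
    obtain ⟨y, hy0, hys, hyc, hyv⟩ := hrf a
    have h1 : reVal tl hd t a y ≤ ∑ a' ∈ (C a).erase a, reArcFlow tl hd t a y a' := by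
      refine sumOver_biUnion_le y hy0 _ _ (fun i => hfin _ _ _) _ ?_
      rintro P ⟨hP, haP⟩
      obtain ⟨b, hb, hbP⟩ := hcut P hP
      exact ⟨b, Finset.mem_erase.2 ⟨fun h => haP (h ▸ hbP), hb⟩, hP, haP, hbP⟩
    have h2 : ∑ a' ∈ (C a).erase a, reArcFlow tl hd t a y a'
        ≤ ∑ a' ∈ (C a).erase a, availCap tl hd s t u x a a' :=
      Finset.sum_le_sum fun b hb => hyc b (Finset.ne_of_mem_erase hb)
    simp only [availCap, Finset.sum_sub_distrib] at h2
    have h3 := sumOver_biUnion_le x hx0 ((C a).erase a)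
      (fun b => {P | IsPath tl hd s t P ∧ b ∈ P ∧ ¬ Before P a b}) (fun i => hfin _ _ _)
      {P | IsPath tl hd s t P ∧ ∃ b ∈ (C a).erase a, b ∈ P ∧ ¬ Before P a b}
      (fun P hP => by
        obtain ⟨hP, b, hb, h⟩ := hP
        exact ⟨b, hb, hP, h⟩)
    have h4 : sumOver x {P | IsPath tl hd s t P ∧ ∃ b ∈ C a, b ∈ P} ≤
        arcFlow tl hd s t x a +
        sumOver x {P | IsPath tl hd s t P ∧ ∃ b ∈ (C a).erase a, b ∈ P ∧ ¬ Before P a b} := by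
      refine sumOver_union_le x hx0 (hfin _ _ _) (hfin _ _ _) ?_
      rintro P ⟨hP, b, hb, hbP⟩
      by_cases haP : a ∈ P
      · exact Or.inl ⟨hP, haP⟩
      · refine Or.inr ⟨hP, b, Finset.mem_erase.2 ⟨fun h => haP (h ▸ hbP), hb⟩, hbP, ?_⟩
        rintro ⟨l₁, l₂, l₃, rfl⟩
        simp at haP
    linarith
  have main : ∀ S : Finset A, IsCutIn tl hd s t (R.biUnion C) S →
      flowVal tl hd s t x ≤ ∑ a ∈ S, u a + ∑ a ∈ R, ∑ a' ∈ (C a).erase a, u a' := by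
    intro S hS
    have h1 : flowVal tl hd s t x ≤ sumOver x {P | IsPath tl hd s t P ∧ ∃ b ∈ S, b ∈ P} +
        sumOver x {P | IsPath tl hd s t P ∧ ∃ a ∈ R, ∃ b ∈ C a, b ∈ P} := by
      refine sumOver_union_le x hx0 (hfin _ _ _) (hfin _ _ _) ?_
      intro P hP
      by_cases h : ∀ a ∈ P, a ∉ R.biUnion C
      · exact Or.inl ⟨hP, hS.2 P hP h⟩
      · push Not at h
        obtain ⟨b, hbP, hb⟩ := h
        obtain ⟨a, ha, hb⟩ := Finset.mem_biUnion.1 hb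
        exact Or.inr ⟨hP, a, ha, b, hb, hbP⟩
    have h2 : sumOver x {P | IsPath tl hd s t P ∧ ∃ b ∈ S, b ∈ P} ≤
        ∑ a ∈ S, arcFlow tl hd s t x a := by
      refine sumOver_biUnion_le x hx0 _ _ (fun i => hfin _ _ _) _ ?_
      rintro P ⟨hP, b, hb, hbP⟩
      exact ⟨b, hb, hP, hbP⟩
    have h3 : sumOver x {P | IsPath tl hd s t P ∧ ∃ a ∈ R, ∃ b ∈ C a, b ∈ P} ≤
        ∑ a ∈ R, sumOver x {P | IsPath tl hd s t P ∧ ∃ b ∈ C a, b ∈ P} := by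
      refine sumOver_biUnion_le x hx0 _ _ (fun i => hfin _ _ _) _ ?_
      rintro P ⟨hP, a, ha, h⟩
      exact ⟨a, ha, hP, h⟩
    have h4 := Finset.sum_le_sum key
    have h5 : ∑ a ∈ S, arcFlow tl hd s t x a ≤ ∑ a ∈ S, u a :=
      Finset.sum_le_sum fun a _ => hxc a
    linarith
  unfold rcutCap minCutCap
  rw [← sub_le_iff_le_add]
  apply le_csInf
  · refine ⟨_, Finset.univ \ R.biUnion C, ⟨Finset.sdiff_disjoint, ?_⟩, rfl⟩
    intro L hL hd'
    cases L with
    | nil => exact absurd hL.1 hst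
    | cons a L =>
      exact ⟨a, Finset.mem_sdiff.2 ⟨Finset.mem_univ _, hd' a (by simp)⟩, by simp⟩
  · rintro c ⟨S, hS, rfl⟩
    rw [sub_le_iff_le_add]
    exact main S hS
end

section
/- Let x be a reroutable s-t-flow, let a ∈ A, and let C be a tail(a)-t-cut containing a. Then the total flow on paths meeting C is at most the capacity of C minus a, i.e., ∑_{P∈𝒫 : P∩C≠∅} x(P) ≤ ∑_{a'∈C∖{a}} u(a'). -/
open scoped BigOperators

variable {V A : Type}

open Classical in
theorem sumOver_eq_sum {A : Type} (x : List A → ℝ) (F : Finset (List A))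
    (hF : ∀ P, P ∉ F → x P = 0) (S : Set (List A)) :
    sumOver x S = ∑ P ∈ F, if P ∈ S then x P else 0 := by
  unfold sumOver
  rw [finsum_mem_def, finsum_eq_sum_of_support_subset (s := F)]
  · rfl
  · intro P hP
    by_contra h
    apply hP
    have := hF P h
    simp [Set.indicator, this]

theorem exists_finset_nodup (A : Type) [Fintype A] [DecidableEq A] :
    ∃ F : Finset (List A), ∀ P : List A, P.Nodup → P ∈ F := by
  have h : {P : List A | P.Nodup}.Finite := by
    have : Finite {P : List A // P.Nodup} := inferInstanceAs (Finite {P : List A // P.Nodup})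
    exact Set.finite_coe_iff.1 this
  exact ⟨h.toFinset, fun P hP => by simpa using hP⟩

theorem IsPath.list_nodup {V A : Type} {tl hd : A → V} {v w : V} {L : List A}
    (h : IsPath tl hd v w L) : L.Nodup :=
  List.Nodup.of_map hd (List.nodup_cons.1 h.2).2

/-- Covering inequality: if `S ⊆ ⋃ T i` then the sums are subadditive. -/
theorem sumOver_le_sum {A ι : Type} (x : List A → ℝ) (F : Finset (List A))
    (hF : ∀ P, P ∉ F → x P = 0) (h0 : ∀ P, 0 ≤ x P) (S : Set (List A)) (I : Finset ι)
    (T : ι → Set (List A)) (h : ∀ P ∈ S, ∃ i ∈ I, P ∈ T i) :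
    sumOver x S ≤ ∑ i ∈ I, sumOver x (T i) := by
  classical
  simp only [sumOver_eq_sum x F hF]
  rw [Finset.sum_comm]
  refine Finset.sum_le_sum fun P _ => ?_
  have hnn : ∀ i ∈ I, 0 ≤ (if P ∈ T i then x P else 0) := by
    intro i _
    split_ifs
    · exact h0 P
    · exact le_rfl
  by_cases hP : P ∈ S
  · obtain ⟨i, hi, hPi⟩ := h P hP
    have := Finset.single_le_sum hnn hi
    simpa [hP, hPi] using this
  · rw [if_neg hP]
    exact Finset.sum_nonneg hnn

theorem reroutable_flow_through_cut_le
    {V A : Type} [Fintype V] [DecidableEq V] [Fintype A] [DecidableEq A]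
    (tl hd : A → V) (s t : V) (u : A → ℝ) (hu : ∀ a, 0 ≤ u a)
    (x : List A → ℝ) (hx : IsFlow tl hd s t u x)
    (hrf : Reroutable tl hd s t u x)
    (a : A) (C : Finset A) (haC : a ∈ C) (hC : IsCut tl hd (tl a) t C) :
    sumOver x {P | IsPath tl hd s t P ∧ ∃ a' ∈ C, a' ∈ P} ≤ ∑ a' ∈ C.erase a, u a' := by
  obtain ⟨F, hF⟩ := exists_finset_nodup A
  obtain ⟨y, hy0, hys, hyc, hyv⟩ := hrf a
  obtain ⟨hx0, hxs, -⟩ := hx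
  have hxF : ∀ P, P ∉ F → x P = 0 := fun P hP =>
    hxs P fun h => hP (hF P h.list_nodup)
  have hyF : ∀ P, P ∉ F → y P = 0 := fun P hP =>
    hys P fun h => hP (hF P h.1.list_nodup)
  have h1 : reVal tl hd t a y ≤ ∑ a' ∈ C.erase a, reArcFlow tl hd t a y a' := by
    refine sumOver_le_sum y F hyF hy0 _ _ _ ?_
    rintro Q ⟨hQ, haQ⟩
    obtain ⟨b, hbC, hbQ⟩ := hC Q hQ
    exact ⟨b, Finset.mem_erase.2 ⟨fun h => haQ (h ▸ hbQ), hbC⟩, hQ, haQ, hbQ⟩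
  have h2 : ∑ a' ∈ C.erase a, reArcFlow tl hd t a y a' ≤
      ∑ a' ∈ C.erase a, availCap tl hd s t u x a a' :=
    Finset.sum_le_sum fun b hb => hyc b (Finset.ne_of_mem_erase hb)
  have h3 := sumOver_le_sum x F hxF hx0
    {P | IsPath tl hd s t P ∧ ∃ a' ∈ C, a' ∈ P} C
    (fun b => if b = a then {P | IsPath tl hd s t P ∧ a ∈ P} else
      {P | IsPath tl hd s t P ∧ b ∈ P ∧ ¬ Before P a b}) (by
    rintro P ⟨hP, b, hbC, hbP⟩
    by_cases haP : a ∈ P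
    · exact ⟨a, haC, by simpa using ⟨hP, haP⟩⟩
    · refine ⟨b, hbC, ?_⟩
      have hba : b ≠ a := fun h => haP (h ▸ hbP)
      simp only [if_neg hba]
      refine ⟨hP, hbP, ?_⟩
      rintro ⟨l₁, l₂, l₃, rfl⟩
      exact haP (by simp))
  rw [← Finset.add_sum_erase C _ haC, if_pos rfl] at h3
  have h4 : ∑ b ∈ C.erase a, sumOver x (if b = a then {P | IsPath tl hd s t P ∧ a ∈ P} else
      {P | IsPath tl hd s t P ∧ b ∈ P ∧ ¬ Before P a b}) =
      ∑ b ∈ C.erase a, sumOver x {P | IsPath tl hd s t P ∧ b ∈ P ∧ ¬ Before P a b} :=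
    Finset.sum_congr rfl fun b hb => by rw [if_neg (Finset.ne_of_mem_erase hb)]
  rw [h4] at h3
  simp only [availCap, Finset.sum_sub_distrib] at h2
  rw [hyv] at h1
  unfold arcFlow at h1
  linarith
end

section
/- There exist a strictly reroutable s-t-flow x and an R-cut (R, (C_a)_{a∈R}) such that cap(R,C) ≤ 2·val(x). In particular, the maximum value of a strictly reroutable flow is at least half the minimum capacity of an R-cut. -/
open scoped BigOperators

variable {V A : Type}

section Helpers

theorem aux_pos_lb {ι : Type*} [Finite ι] (f : ι → ℝ) (hf : ∀ i, 0 < f i) :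
    ∃ ε : ℝ, 0 < ε ∧ ∀ i, ε ≤ f i := by
  rcases isEmpty_or_nonempty ι with h | h
  · exact ⟨1, one_pos, fun i => h.elim i⟩
  · obtain ⟨i, hi⟩ := Finite.exists_min f
    exact ⟨f i, hf i, hi⟩

theorem aux_nodup (tl hd : A → V) {v w : V} {L : List A} (h : IsPath tl hd v w L) :
    L.Nodup := by
  have := h.2
  rw [List.nodup_cons] at this
  exact List.Nodup.of_map _ this.2

theorem aux_finite [Finite A] (tl hd : A → V) (v w : V) :
    {L : List A | IsPath tl hd v w L}.Finite := by
  classical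
  haveI := Fintype.ofFinite A
  have h : {L : List A | L.Nodup}.Finite := by
    have : Finite {L : List A // L.Nodup} := inferInstance
    exact Set.finite_coe_iff.1 this
  exact h.subset fun L hL => aux_nodup tl hd hL

/-- The finset of paths. -/
noncomputable def pths [Finite A] (tl hd : A → V) (v w : V) : Finset (List A) :=
  (aux_finite tl hd v w).toFinset

theorem mem_pths [Finite A] (tl hd : A → V) (v w : V) (L : List A) :
    L ∈ pths tl hd v w ↔ IsPath tl hd v w L := by
  simp [pths]

theorem sumOver_eq [Finite A] (tl hd : A → V) (v w : V) (x : List A → ℝ) (q : List A → Prop)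
    [DecidablePred q] :
    sumOver x {P | IsPath tl hd v w P ∧ q P} = ∑ P ∈ pths tl hd v w, if q P then x P else 0 := by
  rw [← Finset.sum_filter, sumOver, ← finsum_mem_coe_finset]
  congr 1
  ext P
  simp [mem_pths]

theorem arcFlow_eq [Finite A] [DecidableEq A] (tl hd : A → V) (v w : V) (x : List A → ℝ) (a : A) :
    arcFlow tl hd v w x a = ∑ P ∈ pths tl hd v w, if a ∈ P then x P else 0 :=
  sumOver_eq tl hd v w x _

theorem flowVal_eq [Finite A] (tl hd : A → V) (v w : V) (x : List A → ℝ) :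
    flowVal tl hd v w x = ∑ P ∈ pths tl hd v w, x P := by
  have := sumOver_eq tl hd v w x (fun _ => True)
  simpa [flowVal] using this

theorem reArcFlow_eq [Finite A] [DecidableEq A] (tl hd : A → V) (t : V) (b : A) (x : List A → ℝ) (a : A) :
    reArcFlow tl hd t b x a =
      ∑ P ∈ pths tl hd (tl b) t, if b ∉ P ∧ a ∈ P then x P else 0 :=
  sumOver_eq tl hd _ _ x _

theorem reVal_eq [Finite A] [DecidableEq A] (tl hd : A → V) (t : V) (b : A) (x : List A → ℝ) :
    reVal tl hd t b x = ∑ P ∈ pths tl hd (tl b) t, if b ∉ P then x P else 0 :=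
  sumOver_eq tl hd _ _ x _

theorem aux_suffix (tl hd : A → V) (p w : V) : ∀ (L : List A) (q : V),
    IsPath tl hd q w L → p ∈ q :: L.map hd → ∃ L', IsPath tl hd p w L' ∧ ∀ a ∈ L', a ∈ L := by
  intro L
  induction L with
  | nil =>
    intro q h hp
    have : p = q := by simpa using hp
    subst this
    exact ⟨[], h, by simp⟩
  | cons a L ih =>
    intro q h hp
    rcases List.mem_cons.1 hp with hp | hp
    · subst hp
      exact ⟨a :: L, h, fun _ h => h⟩
    · have h' : IsPath tl hd (hd a) w L := ⟨h.1.2, (List.nodup_cons.1 h.2).2⟩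
      obtain ⟨L', h1, h2⟩ := ih (hd a) h' hp
      exact ⟨L', h1, fun c hc => List.mem_cons_of_mem _ (h2 c hc)⟩

theorem aux_path_of_reach (tl hd : A → V) (g : A → Prop) (v w : V)
    (h : Relation.ReflTransGen (fun p q => ∃ a, tl a = p ∧ hd a = q ∧ g a) v w) :
    ∃ L, IsPath tl hd v w L ∧ ∀ a ∈ L, g a := by
  classical
  induction h using Relation.ReflTransGen.head_induction_on with
  | refl => exact ⟨[], ⟨rfl, by simp⟩, by simp⟩
  | head h1 _ ih =>
    rename_i p q _
    obtain ⟨a, ha, hb, hg⟩ := h1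
    obtain ⟨L, hL, hLg⟩ := ih
    by_cases hp : p ∈ q :: L.map hd
    · obtain ⟨L', h1, h2⟩ := aux_suffix tl hd p w L q hL hp
      exact ⟨L', h1, fun c hc => hLg c (h2 c hc)⟩
    · refine ⟨a :: L, ⟨⟨ha, hb ▸ hL.1⟩, ?_⟩, ?_⟩
      · subst hb
        exact List.nodup_cons.2 ⟨hp, hL.2⟩
      · intro c hc
        rcases List.mem_cons.1 hc with rfl | hc
        · exact hg
        · exact hLg c hc

open Classical in
/-- Indicator that `a` leaves `S`. -/
noncomputable def lv (tl hd : A → V) (S : Set V) (a : A) : ℝ :=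
  if tl a ∈ S ∧ hd a ∉ S then 1 else 0

theorem lv_nonneg (tl hd : A → V) (S : Set V) (a : A) : 0 ≤ lv tl hd S a := by
  unfold lv; split_ifs <;> norm_num

theorem lv_le_one (tl hd : A → V) (S : Set V) (a : A) : lv tl hd S a ≤ 1 := by
  unfold lv; split_ifs <;> norm_num

open Classical in
theorem aux_cross (tl hd : A → V) (S : Set V) (w : V) : ∀ (L : List A) (v : V),
    IsWalk tl hd v w L → (∀ a ∈ L, ¬ (tl a ∉ S ∧ hd a ∈ S)) →
    (L.map (lv tl hd S)).sum = (if v ∈ S then 1 else 0) - (if w ∈ S then 1 else 0) := by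
  intro L
  induction L with
  | nil => intro v h _; cases h; simp
  | cons a L ih =>
    intro v h hb
    have := ih (hd a) h.2 (fun c hc => hb c (List.mem_cons_of_mem _ hc))
    rw [List.map_cons, List.sum_cons, this]
    have h0 := hb a List.mem_cons_self
    rw [← h.1]
    unfold lv
    by_cases h1 : tl a ∈ S <;> by_cases h2 : hd a ∈ S <;> by_cases h3 : w ∈ S <;>
      simp_all

theorem aux_meet (tl hd : A → V) (S : Set V) (w : V) (hw : w ∉ S) : ∀ (L : List A) (v : V),
    IsWalk tl hd v w L → v ∈ S → ∃ a ∈ L, tl a ∈ S ∧ hd a ∉ S := by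
  intro L
  induction L with
  | nil => intro v h hv; cases h; exact absurd hv hw
  | cons a L ih =>
    intro v h hv
    by_cases h2 : hd a ∈ S
    · obtain ⟨c, hc, h3⟩ := ih (hd a) h.2 h2
      exact ⟨c, List.mem_cons_of_mem _ hc, h3⟩
    · exact ⟨a, List.mem_cons_self, by rw [h.1]; exact hv, h2⟩

theorem aux_submod [Fintype A] (tl hd : A → V) (S T : Set V) (c : A → ℝ) (hc : ∀ a, 0 ≤ c a)
    (a : A) (h1 : tl a ∉ S) (h2 : hd a ∈ S) (h3 : tl a ∈ T) (h4 : hd a ∉ T) :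
    ∑ e, c e * lv tl hd (S ∩ T) e + ∑ e, c e * lv tl hd (S ∪ T) e + c a ≤
      ∑ e, c e * lv tl hd S e + ∑ e, c e * lv tl hd T e := by
  classical
  have : c a = ∑ e, if e = a then c e else 0 := by simp
  rw [this, ← Finset.sum_add_distrib, ← Finset.sum_add_distrib, ← Finset.sum_add_distrib]
  apply Finset.sum_le_sum
  intro e _
  have := hc e
  by_cases he : e = a
  · subst he
    simp [lv, h1, h2, h3, h4]
  · unfold lv
    by_cases k1 : tl e ∈ S <;> by_cases k2 : hd e ∈ S <;> by_cases k3 : tl e ∈ T <;>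
      by_cases k4 : hd e ∈ T <;> simp [*]

open Classical in
theorem aux_min [Fintype A] (tl hd : A → V) (v w : V) (hne : v ≠ w) (c : A → ℝ)
    (hc : ∀ a, 0 ≤ c a) (M : ℝ)
    (hM : ∀ S : Set V, v ∈ S → w ∉ S → M ≤ ∑ e, c e * lv tl hd S e) :
    ∃ (x : List A → ℝ) (r : A → ℝ), (∀ P, 0 ≤ x P) ∧ (∀ P, ¬ IsPath tl hd v w P → x P = 0) ∧
      (∀ a, 0 ≤ r a) ∧
      (∀ a, (∑ P ∈ pths tl hd v w, if a ∈ P then x P else 0) + r a ≤ c a) ∧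
      (∀ S : Set V, v ∈ S → w ∉ S →
        M ≤ ∑ e, r e * lv tl hd S e + ∑ P ∈ pths tl hd v w, x P) ∧
      ∀ (x' : List A → ℝ) (r' : A → ℝ), (∀ P, 0 ≤ x' P) →
        (∀ P, ¬ IsPath tl hd v w P → x' P = 0) → (∀ a, 0 ≤ r' a) →
        (∀ a, (∑ P ∈ pths tl hd v w, if a ∈ P then x' P else 0) + r' a ≤ c a) →
        (∀ S : Set V, v ∈ S → w ∉ S →
          M ≤ ∑ e, r' e * lv tl hd S e + ∑ P ∈ pths tl hd v w, x' P) →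
        ∑ a, r a ≤ ∑ a, r' a := by
  let K : Set ((List A → ℝ) × (A → ℝ)) := {z | (∀ P, 0 ≤ z.1 P) ∧
      (∀ P, ¬ IsPath tl hd v w P → z.1 P = 0) ∧
      (∀ a, 0 ≤ z.2 a) ∧
      (∀ a, (∑ P ∈ pths tl hd v w, if a ∈ P then z.1 P else 0) + z.2 a ≤ c a) ∧
      (∀ S : Set V, v ∈ S → w ∉ S →
        M ≤ ∑ e, z.2 e * lv tl hd S e + ∑ P ∈ pths tl hd v w, z.1 P)}
  have hcl : IsClosed K := by
    refine IsClosed.and ?_ (IsClosed.and ?_ (IsClosed.and ?_ (IsClosed.and ?_ ?_)))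
    · simp only [Set.setOf_forall]
      exact isClosed_iInter fun P => isClosed_le (by fun_prop) (by fun_prop)
    · simp only [Set.setOf_forall]
      exact isClosed_iInter fun P => isClosed_iInter fun _ => isClosed_eq (by fun_prop) (by fun_prop)
    · simp only [Set.setOf_forall]
      exact isClosed_iInter fun P => isClosed_le (by fun_prop) (by fun_prop)
    · simp only [Set.setOf_forall]
      refine isClosed_iInter fun a => isClosed_le ?_ (by fun_prop)
      refine Continuous.add (continuous_finsetSum _ fun P _ => ?_) (by fun_prop)
      split_ifs <;> fun_prop
    · simp only [Set.setOf_forall]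
      exact isClosed_iInter fun P => isClosed_iInter fun _ => isClosed_iInter fun _ =>
        isClosed_le (by fun_prop) (by fun_prop)
  have hsub : K ⊆ (Set.univ.pi fun _ => Set.Icc 0 (∑ a, c a)) ×ˢ
      (Set.univ.pi fun a => Set.Icc 0 (c a)) := by
    rintro ⟨x, r⟩ ⟨h1, h2, h3, h4, h5⟩
    dsimp only at h1 h2 h3 h4 h5
    have hterm : ∀ a, ∀ P ∈ pths tl hd v w, 0 ≤ if a ∈ P then x P else 0 := by
      intro a P _; split_ifs
      · exact h1 P
      · exact le_rfl
    refine ⟨fun P _ => ⟨h1 P, ?_⟩, fun a _ => ⟨h3 a, ?_⟩⟩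
    · try dsimp only
      by_cases hP : IsPath tl hd v w P
      · cases P with
        | nil => exact absurd hP.1 hne
        | cons a L =>
          have e1 := Finset.single_le_sum (hterm a) ((mem_pths tl hd v w _).2 hP)
          rw [if_pos List.mem_cons_self] at e1
          have e2 := Finset.single_le_sum (fun a _ => hc a) (Finset.mem_univ a)
          linarith [h4 a, h3 a]
      · rw [h2 P hP]; exact Finset.sum_nonneg fun a _ => hc a
    · try dsimp only
      linarith [h4 a, Finset.sum_nonneg (hterm a)]
  have hK : IsCompact K := by
    refine IsCompact.of_isClosed_subset ?_ hcl hsub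
    exact (isCompact_univ_pi fun _ => isCompact_Icc).prod (isCompact_univ_pi fun _ => isCompact_Icc)
  have hn : K.Nonempty := by
    refine ⟨(fun _ => 0, c), fun _ => le_rfl, fun _ _ => rfl, hc, fun a => by simp, ?_⟩
    intro S h1 h2
    simpa using hM S h1 h2
  obtain ⟨z, hz, hmin⟩ := hK.exists_isMinOn hn
    (f := fun z => ∑ a, z.2 a) (Continuous.continuousOn (by fun_prop))
  obtain ⟨h1, h2, h3, h4, h5⟩ := hz
  refine ⟨z.1, z.2, h1, h2, h3, h4, h5, ?_⟩
  intro x' r' g1 g2 g3 g4 g5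
  exact hmin (show (x', r') ∈ K from ⟨g1, g2, g3, g4, g5⟩)

theorem mfmc [Fintype V] [Fintype A] (tl hd : A → V) (v w : V) (hne : v ≠ w) (c : A → ℝ)
    (hc : ∀ a, 0 ≤ c a) :
    ∃ x, IsFlow tl hd v w c x ∧ ∃ C : Finset A, IsCut tl hd v w C ∧
      ∑ a ∈ C, c a ≤ flowVal tl hd v w x := by
  classical
  haveI : Nonempty {S : Set V // v ∈ S ∧ w ∉ S} := ⟨⟨{v}, rfl, fun h => hne h.symm⟩⟩
  obtain ⟨⟨S₀, hS1, hS2⟩, hS₀⟩ := Finite.exists_min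
    (fun S : {S : Set V // v ∈ S ∧ w ∉ S} => ∑ e, c e * lv tl hd S.1 e)
  obtain ⟨M, hMdef⟩ : ∃ M, M = ∑ e, c e * lv tl hd S₀ e := ⟨_, rfl⟩
  obtain ⟨x, r, h1, h2, h3, h4, h5, hmin⟩ := aux_min tl hd v w hne c hc M
    (fun S k1 k2 => by rw [hMdef]; exact hS₀ ⟨S, k1, k2⟩)
  -- every positive arc is in a tight cut
  have hstep1 : ∀ a, 0 < r a → ∃ T : Set V, v ∈ T ∧ w ∉ T ∧ tl a ∈ T ∧ hd a ∉ T ∧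
      ∑ e, r e * lv tl hd T e + ∑ P ∈ pths tl hd v w, x P = M := by
    intro a ha
    by_contra! hcon
    obtain ⟨ε, hε, hεle⟩ := aux_pos_lb
      (fun T : {T : Set V // v ∈ T ∧ w ∉ T ∧ tl a ∈ T ∧ hd a ∉ T} =>
        ∑ e, r e * lv tl hd T.1 e + ∑ P ∈ pths tl hd v w, x P - M)
      (fun ⟨T, k1, k2, k3, k4⟩ => by
        have := h5 T k1 k2
        have := lt_of_le_of_ne this (Ne.symm (hcon T k1 k2 k3 k4))
        (try dsimp only); linarith)
    obtain ⟨δ, hδ⟩ : ∃ δ, δ = min ε (r a) := ⟨_, rfl⟩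
    have hδ0 : 0 < δ := hδ ▸ lt_min hε ha
    have hδ1 : δ ≤ ε := hδ ▸ min_le_left _ _
    have hδ2 : δ ≤ r a := hδ ▸ min_le_right _ _
    have := hmin x (fun e => r e - if e = a then δ else 0) h1 h2 ?_ ?_ ?_
    · rw [Finset.sum_sub_distrib] at this
      simp at this
      linarith
    · intro e
      try dsimp only
      split_ifs with h
      · subst h; linarith
      · linarith [h3 e]
    · intro e
      have := h4 e
      try dsimp only
      split_ifs <;> linarith
    · intro T k1 k2
      have e1 : ∑ e, (r e - if e = a then δ else 0) * lv tl hd T e =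
          ∑ e, r e * lv tl hd T e - δ * lv tl hd T a := by
        simp [sub_mul, Finset.sum_sub_distrib]
      rw [e1]
      by_cases k : tl a ∈ T ∧ hd a ∉ T
      · have := hεle ⟨T, k1, k2, k.1, k.2⟩
        dsimp only at this
        rw [lv, if_pos k]
        linarith
      · rw [lv, if_neg k]
        linarith [h5 T k1 k2]
  -- no path with positive residual capacity
  have hstep2 : ∀ L, IsPath tl hd v w L → ¬ ∀ a ∈ L, 0 < r a := by
    intro L hL hpos
    have hnd := aux_nodup tl hd hL
    have hsumL : ∀ f : A → ℝ, (L.map f).sum = ∑ e, if e ∈ L then f e else 0 := by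
      intro f
      rw [← List.sum_toFinset f hnd, ← Finset.sum_filter]
      congr 1
      ext e; simp
    have htight : ∀ S : Set V, v ∈ S → w ∉ S →
        ∑ e, r e * lv tl hd S e + ∑ P ∈ pths tl hd v w, x P = M →
        ∑ e, (if e ∈ L then lv tl hd S e else 0) = 1 := by
      intro S k1 k2 k3
      rw [← hsumL, aux_cross tl hd S w L v hL.1]
      · simp [k1, k2]
      · rintro a ha ⟨m1, m2⟩
        obtain ⟨T, n1, n2, n3, n4, n5⟩ := hstep1 a (hpos a ha)
        have q1 := aux_submod tl hd S T r h3 a m1 m2 n3 n4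
        have q2 := h5 (S ∩ T) ⟨k1, n1⟩ (fun h => k2 h.1)
        have q3 := h5 (S ∪ T) (Or.inl k1) (fun h => h.elim k2 n2)
        have q4 := hpos a ha
        linarith
    obtain ⟨ε₁, hε₁, hε₁le⟩ := aux_pos_lb (fun a : {a // a ∈ L} => r a.1)
      (fun a => hpos a.1 a.2)
    obtain ⟨ε₂, hε₂, hε₂le⟩ := aux_pos_lb
      (fun T : {T : Set V // (v ∈ T ∧ w ∉ T) ∧
        M < ∑ e, r e * lv tl hd T e + ∑ P ∈ pths tl hd v w, x P} =>
        ∑ e, r e * lv tl hd T.1 e + ∑ P ∈ pths tl hd v w, x P - M)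
      (fun T => by have := T.2.2; (try dsimp only); linarith)
    obtain ⟨N, hN⟩ : ∃ N : ℝ, N = (Fintype.card A : ℝ) + 1 := ⟨_, rfl⟩
    have hN0 : 0 < N := by rw [hN]; positivity
    obtain ⟨δ, hδ⟩ : ∃ δ, δ = min ε₁ (ε₂ / N) := ⟨_, rfl⟩
    have hδ0 : 0 < δ := hδ ▸ lt_min hε₁ (div_pos hε₂ hN0)
    have hδ1 : δ ≤ ε₁ := hδ ▸ min_le_left _ _
    have hδ2 : δ * N ≤ ε₂ := by
      rw [← le_div_iff₀ hN0]; exact hδ ▸ min_le_right _ _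
    have hLm : L ∈ pths tl hd v w := (mem_pths tl hd v w L).2 hL
    have hval : ∑ P ∈ pths tl hd v w, (x P + if P = L then δ else 0) =
        ∑ P ∈ pths tl hd v w, x P + δ := by
      rw [Finset.sum_add_distrib, Finset.sum_ite_eq' , if_pos hLm]
    have := hmin (fun P => x P + if P = L then δ else 0)
      (fun e => r e - if e ∈ L then δ else 0) ?_ ?_ ?_ ?_ ?_
    · rw [Finset.sum_sub_distrib] at this
      cases L with
      | nil => exact hne hL.1
      | cons a L' =>
        have := Finset.single_le_sum (f := fun e => if e ∈ a :: L' then δ else 0)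
          (fun e _ => by (try dsimp only); split_ifs <;> linarith) (Finset.mem_univ a)
        rw [if_pos List.mem_cons_self] at this
        linarith
    · intro P
      have := h1 P
      try dsimp only
      split_ifs <;> linarith
    · intro P hP
      have : P ≠ L := fun h => hP (h ▸ hL)
      simp [this, h2 P hP]
    · intro e
      try dsimp only
      split_ifs with h
      · have := hε₁le ⟨e, h⟩
        dsimp only at this
        linarith
      · linarith [h3 e]
    · intro a
      have e1 : (∑ P ∈ pths tl hd v w, if a ∈ P then (x P + if P = L then δ else 0) else 0) =
          (∑ P ∈ pths tl hd v w, if a ∈ P then x P else 0) + if a ∈ L then δ else 0 := by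
        have : (if a ∈ L then δ else 0) = ∑ P ∈ pths tl hd v w,
            if P = L then (if a ∈ P then δ else 0) else 0 := by
          rw [Finset.sum_ite_eq', if_pos hLm]
        rw [this, ← Finset.sum_add_distrib]
        apply Finset.sum_congr rfl
        intro P _
        split_ifs <;> simp
      try dsimp only
      rw [e1]
      linarith [h4 a]
    · intro T k1 k2
      have e1 : ∑ e, (r e - if e ∈ L then δ else 0) * lv tl hd T e =
          ∑ e, r e * lv tl hd T e - δ * ∑ e, (if e ∈ L then lv tl hd T e else 0) := by
        rw [Finset.mul_sum, ← Finset.sum_sub_distrib]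
        apply Finset.sum_congr rfl
        intro e _
        split_ifs <;> ring
      try dsimp only
      rw [hval, e1]
      rcases eq_or_lt_of_le (h5 T k1 k2) with h | h
      · rw [htight T k1 k2 h.symm]; linarith
      · have q1 := hε₂le ⟨T, ⟨k1, k2⟩, h⟩
        dsimp only at q1
        have q2 : ∑ e, (if e ∈ L then lv tl hd T e else 0) ≤ N := by
          calc ∑ e, (if e ∈ L then lv tl hd T e else 0) ≤ ∑ e : A, (1 : ℝ) := by
                apply Finset.sum_le_sum
                intro e _
                split_ifs
                · exact lv_le_one tl hd T e
                · norm_num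
            _ ≤ N := by simp [hN]
        have q3 := mul_le_mul_of_nonneg_left q2 hδ0.le
        linarith
  have hfin : M ≤ ∑ P ∈ pths tl hd v w, x P := by
    have := h5 {p | Relation.ReflTransGen (fun p q => ∃ a, tl a = p ∧ hd a = q ∧ 0 < r a) v p}
      Relation.ReflTransGen.refl (by
        intro h
        obtain ⟨L, hL, hg⟩ := aux_path_of_reach tl hd (fun a => 0 < r a) v w h
        exact hstep2 L hL hg)
    rw [Finset.sum_eq_zero] at this
    · linarith
    · intro e _
      rw [lv]
      split_ifs with h
      · have : ¬ 0 < r e := fun hr => h.2 (Relation.ReflTransGen.tail h.1 ⟨e, rfl, rfl, hr⟩)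
        have : r e = 0 := le_antisymm (not_lt.1 this) (h3 e)
        simp [this]
      · simp
  refine ⟨x, ⟨h1, h2, fun a => ?_⟩,
    Finset.univ.filter (fun a => tl a ∈ S₀ ∧ hd a ∉ S₀), ?_, ?_⟩
  · rw [arcFlow_eq]
    linarith [h4 a, h3 a]
  · intro L hL
    obtain ⟨a, ha, hb⟩ := aux_meet tl hd S₀ w hS2 L v hL.1 hS1
    exact ⟨a, by simpa using hb, ha⟩
  · rw [flowVal_eq, Finset.sum_filter]
    refine le_trans (le_of_eq ?_) hfin
    rw [hMdef]
    apply Finset.sum_congr rfl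
    intro e _
    rw [lv]
    split_ifs <;> simp

theorem aux_reroute [Fintype V] [Fintype A] [DecidableEq A] (tl hd : A → V) (t : V) (u : A → ℝ)
    (hu : ∀ a, 0 ≤ u a) (b : A) :
    ∃ (m : ℝ) (z : List A → ℝ) (C : Finset A), 0 ≤ m ∧ m ≤ u b ∧ (∀ Q, 0 ≤ z Q) ∧
      (∀ Q, ¬ (IsPath tl hd (tl b) t Q ∧ b ∉ Q) → z Q = 0) ∧
      (∀ a, reArcFlow tl hd t b z a ≤ u a) ∧ m ≤ reVal tl hd t b z ∧
      (m ≠ u b → b ∈ C ∧ IsCut tl hd (tl b) t C ∧ ∑ a ∈ C.erase b, u a ≤ m) := by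
  classical
  by_cases hb : tl b = t
  · refine ⟨u b, fun Q => if Q = [] then u b else 0, ∅, hu b, le_rfl, ?_, ?_, ?_, ?_, ?_⟩
    · intro Q; (try dsimp only); split_ifs <;> simp [hu b]
    · intro Q hQ
      have : Q ≠ [] := by
        rintro rfl
        exact hQ ⟨⟨hb, by simp⟩, by simp⟩
      simp [this]
    · intro a
      rw [reArcFlow_eq, Finset.sum_eq_zero]
      · exact hu a
      · intro P _
        by_cases hP : P = []
        · subst hP; simp
        · simp [hP]
    · rw [reVal_eq]
      have hm : ([] : List A) ∈ pths tl hd (tl b) t := (mem_pths _ _ _ _ _).2 ⟨hb, by simp⟩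
      have := Finset.single_le_sum
        (f := fun P : List A => if b ∉ P then (if P = [] then u b else 0) else 0)
        (fun P _ => by (try dsimp only); split_ifs <;> simp [hu b]) hm
      simpa using this
    · intro h; exact absurd rfl h
  · obtain ⟨z, ⟨z1, z2, z3⟩, C, hC, hle⟩ := mfmc tl hd (tl b) t hb (Function.update u b 0) (by
      intro a
      by_cases h : a = b
      · subst h; simp
      · simp [h, hu a])
    have hzb : ∀ Q, b ∈ Q → z Q = 0 := by
      intro Q hQ
      by_cases hP : IsPath tl hd (tl b) t Q
      · have := z3 b
        rw [arcFlow_eq, Function.update_self] at this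
        have e := Finset.single_le_sum (f := fun P : List A => if b ∈ P then z P else 0)
          (fun P _ => by (try dsimp only); split_ifs <;> simp [z1 P]) ((mem_pths _ _ _ _ _).2 hP)
        rw [if_pos hQ] at e
        linarith [z1 Q]
      · exact z2 Q hP
    have hval : reVal tl hd t b z = flowVal tl hd (tl b) t z := by
      rw [reVal_eq, flowVal_eq]
      apply Finset.sum_congr rfl
      intro P _
      by_cases h : b ∈ P
      · simp [h, hzb P h]
      · simp [h]
    refine ⟨min (u b) (reVal tl hd t b z), z, insert b C, ?_, min_le_left _ _, z1, ?_, ?_,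
      min_le_right _ _, ?_⟩
    · refine le_min (hu b) ?_
      rw [hval, flowVal_eq]
      exact Finset.sum_nonneg fun P _ => z1 P
    · intro Q hQ
      by_cases h : b ∈ Q
      · exact hzb Q h
      · exact z2 Q fun h' => hQ ⟨h', h⟩
    · intro a
      have e : reArcFlow tl hd t b z a = arcFlow tl hd (tl b) t z a := by
        rw [reArcFlow_eq, arcFlow_eq]
        apply Finset.sum_congr rfl
        intro P _
        by_cases h : b ∈ P
        · simp [hzb P h]
        · simp [h]
      rw [e]
      refine (z3 a).trans ?_
      by_cases h : a = b
      · subst h; simp [hu a]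
      · simp [h]
    · intro hm
      have hm' : min (u b) (reVal tl hd t b z) = reVal tl hd t b z := by
        rcases min_choice (u b) (reVal tl hd t b z) with h | h
        · exact absurd h hm
        · exact h
      refine ⟨Finset.mem_insert_self _ _, ?_, ?_⟩
      · intro L hL
        obtain ⟨a, ha, h⟩ := hC L hL
        exact ⟨a, Finset.mem_insert_of_mem ha, h⟩
      · rw [hm', hval]
        refine le_trans ?_ hle
        rw [Finset.erase_insert_eq_erase]
        calc ∑ a ∈ C.erase b, u a = ∑ a ∈ C.erase b, Function.update u b 0 a := by
              apply Finset.sum_congr rfl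
              intro a ha
              rw [Function.update_of_ne (Finset.ne_of_mem_erase ha)]
          _ ≤ ∑ a ∈ C, Function.update u b 0 a := by
              apply Finset.sum_le_sum_of_subset_of_nonneg (Finset.erase_subset _ _)
              intro a _ _
              by_cases h : a = b
              · subst h; simp
              · simp [h, hu a]

theorem sumOver_smul (k : ℝ) (x : List A → ℝ) (S : Set (List A)) (hS : S.Finite) :
    sumOver (fun P => k * x P) S = k * sumOver x S := by
  rw [sumOver, sumOver, finsum_mem_eq_finite_toFinset_sum _ hS,
    finsum_mem_eq_finite_toFinset_sum _ hS, Finset.mul_sum]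

end Helpers

/-- There exist a strictly reroutable s-t-flow `x` and an R-cut `(R, C)`
with `cap(R, C) ≤ 2 · val(x)`; in particular the maximum strictly reroutable flow value
is at least half the minimum R-cut capacity. -/
theorem exists_strictlyReroutable_flow_and_rcut_within_factor_two
    {V A : Type} [Fintype V] [DecidableEq V] [Fintype A] [DecidableEq A]
    (tl hd : A → V) (s t : V) (u : A → ℝ) (hu : ∀ a, 0 ≤ u a)
    (hcover : ∀ v : V, ∃ L : List A, IsPath tl hd s t L ∧ v ∈ s :: L.map hd) :
    ∃ (x : List A → ℝ) (R : Finset A) (C : A → Finset A),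
      IsFlow tl hd s t u x ∧ StrictlyReroutable tl hd s t u x ∧
        IsRCut tl hd t R C ∧
        rcutCap tl hd s t u R C ≤ 2 * flowVal tl hd s t x := by
  rcases eq_or_ne s t with hst | hst
  · subst hst
    refine ⟨fun _ => 0, ∅, fun _ => ∅, ⟨fun _ => le_rfl, fun _ _ => rfl, ?_⟩, ?_, ?_, ?_⟩
    · intro a; simpa [arcFlow, sumOver] using hu a
    · intro b
      refine ⟨fun _ => 0, fun _ => le_rfl, fun _ _ => rfl, ?_, ?_⟩
      · intro a _; simpa [arcFlow, reArcFlow, sumOver] using hu a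
      · simp [arcFlow, reVal, sumOver]
    · intro a ha; simp at ha
    · have : {c : ℝ | ∃ S : Finset A, IsCutIn tl hd s s ((∅ : Finset A).biUnion fun _ => ∅) S ∧
          c = ∑ a ∈ S, u a} = ∅ := by
        ext c
        simp only [Set.mem_setOf_eq, Set.mem_empty_iff_false, iff_false]
        rintro ⟨S, hS, _⟩
        obtain ⟨a, _, ha⟩ := hS.2 [] ⟨rfl, by simp⟩ (by simp)
        simp at ha
      rw [rcutCap, minCutCap, this]
      simp [flowVal, sumOver]
  · choose m z C hm0 hmu hz1 hz2 hz3 hz4 hC using aux_reroute tl hd t u hu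
    obtain ⟨y, ⟨y1, y2, y3⟩, S, hS, hle⟩ := mfmc tl hd s t hst m hm0
    have hfin : ∀ v w, {P | IsPath tl hd v w P}.Finite := fun v w => aux_finite tl hd v w
    have harc : ∀ a, arcFlow tl hd s t (fun P => 1 / 2 * y P) a = 1 / 2 * arcFlow tl hd s t y a :=
      fun a => sumOver_smul _ _ _ ((hfin s t).subset fun P h => h.1)
    have hval : flowVal tl hd s t (fun P => 1 / 2 * y P) = 1 / 2 * flowVal tl hd s t y :=
      sumOver_smul _ _ _ (hfin s t)
    have hy0 : ∀ a, 0 ≤ arcFlow tl hd s t y a := by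
      classical
      intro a
      rw [arcFlow_eq]
      exact Finset.sum_nonneg fun P _ => by split_ifs <;> simp [y1 P]
    refine ⟨fun P => 1 / 2 * y P, S.filter (fun b => m b ≠ u b), C, ⟨?_, ?_, ?_⟩, ?_, ?_, ?_⟩
    · intro P; have := y1 P; (try dsimp only); linarith
    · intro P hP; simp [y2 P hP]
    · intro a
      rw [harc]
      linarith [y3 a, hmu a, hm0 a]
    · intro b
      have hr0 : 0 ≤ reVal tl hd t b (z b) := (hm0 b).trans (hz4 b)
      obtain ⟨k, hk0, hk1, hk2⟩ : ∃ k : ℝ, 0 ≤ k ∧ k ≤ 1 / 2 ∧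
          k * reVal tl hd t b (z b) = 1 / 2 * arcFlow tl hd s t y b := by
        have h1 := hz4 b
        have h2 := y3 b
        have h3 := hy0 b
        rcases hr0.eq_or_lt with h | h
        · exact ⟨0, le_rfl, by norm_num, by linarith⟩
        · refine ⟨1 / 2 * arcFlow tl hd s t y b / reVal tl hd t b (z b), ?_, ?_, ?_⟩
          · positivity
          · rw [div_le_iff₀ h]; linarith
          · field_simp
      refine ⟨fun Q => k * z b Q, ?_, ?_, ?_, ?_⟩
      · intro Q; exact mul_nonneg hk0 (hz1 b Q)
      · intro Q hQ; simp [hz2 b Q hQ]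
      · intro a _
        have e : reArcFlow tl hd t b (fun Q => k * z b Q) a = k * reArcFlow tl hd t b (z b) a :=
          sumOver_smul _ _ _ ((hfin (tl b) t).subset fun P h => h.1)
        rw [e, harc]
        have q1 := mul_le_mul_of_nonneg_left (hz3 b a) hk0
        have q2 := mul_le_mul_of_nonneg_right hk1 (hu a)
        linarith [y3 a, hmu a]
      · have e : reVal tl hd t b (fun Q => k * z b Q) = k * reVal tl hd t b (z b) :=
          sumOver_smul _ _ _ ((hfin (tl b) t).subset fun P h => h.1)
        rw [e, harc, hk2]
    · intro a ha
      have := hC a (Finset.mem_filter.1 ha).2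
      exact ⟨this.1, this.2.1⟩
    · rw [hval, rcutCap]
      have h1 : minCutCap tl hd s t u ((S.filter (fun b => m b ≠ u b)).biUnion C) ≤
          ∑ a ∈ S \ (S.filter (fun b => m b ≠ u b)).biUnion C, u a := by
        apply csInf_le
        · refine ⟨0, ?_⟩
          rintro c ⟨T, _, rfl⟩
          exact Finset.sum_nonneg fun a _ => hu a
        · refine ⟨_, ⟨Finset.sdiff_disjoint, ?_⟩, rfl⟩
          intro L hL hD
          obtain ⟨a, ha, haL⟩ := hS L hL
          exact ⟨a, Finset.mem_sdiff.2 ⟨ha, hD a haL⟩, haL⟩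
      have h2 : ∑ a ∈ S \ (S.filter (fun b => m b ≠ u b)).biUnion C, u a ≤
          ∑ a ∈ S.filter (fun b => ¬ m b ≠ u b), m a := by
        calc _ ≤ ∑ a ∈ S.filter (fun b => ¬ m b ≠ u b), u a := by
              apply Finset.sum_le_sum_of_subset_of_nonneg
              · intro a ha
                rw [Finset.mem_sdiff] at ha
                refine Finset.mem_filter.2 ⟨ha.1, fun h => ha.2 ?_⟩
                exact Finset.mem_biUnion.2 ⟨a, Finset.mem_filter.2 ⟨ha.1, h⟩, (hC a h).1⟩
              · intro a _ _; exact hu a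
          _ = _ := by
              apply Finset.sum_congr rfl
              intro a ha
              exact (not_not.1 (Finset.mem_filter.1 ha).2).symm
      have h3 : ∑ a ∈ S.filter (fun b => m b ≠ u b), ∑ a' ∈ (C a).erase a, u a' ≤
          ∑ a ∈ S.filter (fun b => m b ≠ u b), m a :=
        Finset.sum_le_sum fun a ha => (hC a (Finset.mem_filter.1 ha).2).2.2
      have h4 := Finset.sum_filter_add_sum_filter_not S (fun b => m b ≠ u b) m
      linarith
end

section
/- For each arc a∈A, let C_a be a tail(a)-t-cut containing a of minimum total capacity u(C_a) among all tail(a)-t-cuts containing a, and define u'(a) := min{u(a), u(C_a∖{a})}. If x' is an s-t-flow with respect to the capacities u' (i.e., x'(a) ≤ u'(a) for all a∈A), then the flow x := (1/2)x' is a strictly reroutable s-t-flow with respect to the original capacities u. -/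
open scoped BigOperators

variable {V A : Type}

lemma aux_walk_append {tl hd : A → V} : ∀ {L M : List A} {v w z : V},
    IsWalk tl hd v w L → IsWalk tl hd w z M → IsWalk tl hd v z (L ++ M)
  | [], M, v, w, z, h, h' => by
      simp only [IsWalk] at h; subst h; simpa using h'
  | a :: L, M, v, w, z, h, h' => by
      exact ⟨h.1, aux_walk_append h.2 h'⟩

/-- tail of a walk starting from a visited vertex -/
lemma aux_walk_suffix {tl hd : A → V} : ∀ {L : List A} {v w z : V},
    IsWalk tl hd v w L → z ∈ L.map hd →
      ∃ M, M.Sublist L ∧ M.length < L.length ∧ IsWalk tl hd z w M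
  | [], v, w, z, h, h' => by simp at h'
  | a :: L, v, w, z, h, h' => by
      by_cases hz : z = hd a
      · subst hz
        exact ⟨L, List.sublist_cons_self a L, by simp, h.2⟩
      · have : z ∈ L.map hd := by simpa [hz] using h'
        obtain ⟨M, h1, h2, h3⟩ := aux_walk_suffix h.2 this
        exact ⟨M, h1.trans (List.sublist_cons_self a L), by simp; omega, h3⟩

lemma aux_walk_path {tl hd : A → V} : ∀ (n : ℕ) {L : List A} {v w : V}, L.length ≤ n →
    IsWalk tl hd v w L → ∃ M, M.Sublist L ∧ IsPath tl hd v w M := by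
  intro n
  induction n with
  | zero =>
    intro L v w hn h
    have : L = [] := by simpa using hn
    subst this
    exact ⟨[], List.Sublist.refl _, h, by simp⟩
  | succ n ih =>
    intro L v w hn h
    by_cases hv : v ∈ L.map hd
    · obtain ⟨M, h1, h2, h3⟩ := aux_walk_suffix h hv
      obtain ⟨M', h4, h5⟩ := ih (by omega) h3
      exact ⟨M', h4.trans h1, h5⟩
    · cases L with
      | nil => exact ⟨[], List.Sublist.refl _, h, by simp⟩
      | cons a L =>
        obtain ⟨M, h1, h2⟩ := ih (by simpa using hn) h.2
        refine ⟨a :: M, h1.cons_cons a, ⟨h.1, h2.1⟩, ?_⟩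
        have h3 : (List.map hd (a :: M)).Nodup := by simpa using h2.2
        refine List.nodup_cons.2 ⟨fun h' => hv ?_, h3⟩
        exact ((h1.cons_cons a).map hd).subset h'

lemma aux_paths_finite [Fintype A] [DecidableEq A] (tl hd : A → V) (v w : V) :
    {L : List A | IsPath tl hd v w L}.Finite := by
  have : {L : List A | L.Nodup}.Finite := by
    haveI : Finite {L : List A // L.Nodup} := inferInstance
    exact Set.finite_coe_iff.1 this
  refine this.subset fun L hL => ?_
  exact List.Nodup.of_map hd (List.nodup_cons.1 hL.2).2

/-- a walk from low to high potential has a crossing arc -/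
lemma aux_cross_s5 {tl hd : A → V} (d : V → ℝ) (θ : ℝ) : ∀ {L : List A} {v w : V},
    IsWalk tl hd v w L → d v ≤ θ → θ < d w → ∃ a ∈ L, d (tl a) ≤ θ ∧ θ < d (hd a)
  | [], v, w, h, h1, h2 => by
      simp only [IsWalk] at h; subst h; linarith
  | a :: L, v, w, h, h1, h2 => by
      by_cases h3 : θ < d (hd a)
      · exact ⟨a, by simp, by rw [h.1]; exact h1, h3⟩
      · obtain ⟨e, he, h4⟩ := aux_cross_s5 d θ h.2 (not_lt.1 h3) h2
        exact ⟨e, by simp [he], h4⟩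

lemma aux_potential [Fintype A] [DecidableEq A] (tl hd : A → V) (r t : V) (b : A)
    (l : A → ℝ) (hl : ∀ a, 0 ≤ l a) (D : ℝ) (hD : 0 ≤ D)
    (hP : ∀ P, IsPath tl hd r t P → b ∉ P → D ≤ (P.map l).sum) :
    ∃ d : V → ℝ, d r ≤ 0 ∧ D ≤ d t ∧ ∀ a, a ≠ b → d (hd a) ≤ d (tl a) + l a := by
  have hnn : ∀ L : List A, 0 ≤ (L.map l).sum := fun L =>
    List.sum_nonneg (by simp only [List.mem_map]; rintro _ ⟨a, _, rfl⟩; exact hl a)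
  let S : V → Set ℝ := fun v => insert D {x | ∃ L, IsWalk tl hd r v L ∧ b ∉ L ∧ x = (L.map l).sum}
  have hne : ∀ v, (S v).Nonempty := fun v => ⟨D, Set.mem_insert _ _⟩
  have hbd : ∀ v, BddBelow (S v) := by
    refine fun v => ⟨0, ?_⟩
    rintro x (rfl | ⟨L, _, _, rfl⟩)
    · exact hD
    · exact hnn L
  refine ⟨fun v => sInf (S v), ?_, ?_, ?_⟩
  · exact csInf_le (hbd r) (Or.inr ⟨[], rfl, by simp, by simp⟩)
  · refine le_csInf (hne t) ?_
    rintro x (rfl | ⟨L, h1, h2, rfl⟩)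
    · exact le_rfl
    · obtain ⟨M, h3, h4⟩ := aux_walk_path _ le_rfl h1
      refine (hP M h4 fun h => h2 (h3.subset h)).trans ?_
      refine (h3.map l).sum_le_sum ?_
      simp only [List.mem_map]; rintro _ ⟨a, _, rfl⟩; exact hl a
  · intro a hab
    rw [← sub_le_iff_le_add]
    refine le_csInf (hne _) ?_
    rintro x (rfl | ⟨L, h1, h2, rfl⟩)
    · have : sInf (S (hd a)) ≤ x := csInf_le (hbd _) (Or.inl rfl)
      linarith [hl a]
    · have : sInf (S (hd a)) ≤ ((L ++ [a]).map l).sum :=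
        csInf_le (hbd _) (Or.inr ⟨L ++ [a], aux_walk_append h1 ⟨rfl, rfl⟩,
          by simp [h2, Ne.symm hab], rfl⟩)
      simp at this
      linarith

open MeasureTheory in
lemma aux_round [Fintype A] [DecidableEq A] (tl hd : A → V) (r t : V) (b : A)
    (l c : A → ℝ) (hl : ∀ a, 0 ≤ l a) (hc : ∀ a, 0 ≤ c a) (D val : ℝ) (hD : 0 ≤ D)
    (hP : ∀ P, IsPath tl hd r t P → b ∉ P → D ≤ (P.map l).sum)
    (hS : ∀ S : Finset A, (∀ P, IsPath tl hd r t P → b ∉ P → ∃ a ∈ S, a ∈ P) →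
      val ≤ ∑ a ∈ S, c a) :
    val * D ≤ ∑ a, c a * l a := by
  classical
  obtain ⟨d, h0, h1, h2⟩ := aux_potential tl hd r t b l hl D hD hP
  let I : A → Set ℝ := fun a => if a = b then ∅ else Set.Ico (d (tl a)) (d (hd a))
  have hIm : ∀ a, MeasurableSet (I a) := by
    intro a; by_cases h : a = b <;> simp [I, h, measurableSet_Ico]
  have hpt : ∀ θ ∈ Set.Ico 0 D, val ≤ ∑ a, (I a).indicator (fun _ => c a) θ := by
    intro θ hθ
    have := hS (Finset.univ.filter fun a => θ ∈ I a) ?_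
    · refine this.trans (le_of_eq ?_)
      rw [Finset.sum_filter]
      simp [Set.indicator_apply]
    · intro P hP hb
      obtain ⟨a, ha, h3⟩ := aux_cross_s5 d θ hP.1 (h0.trans hθ.1) (hθ.2.trans_le h1)
      refine ⟨a, ?_, ha⟩
      have : a ≠ b := fun h => hb (h ▸ ha)
      simp [I, this, h3]
  have hint : ∀ a, IntegrableOn ((I a).indicator (fun _ => c a)) (Set.Ico 0 D) := by
    intro a
    exact (integrableOn_const (by simp)).indicator (hIm a)
  have h3 : ∫ _ in Set.Ico 0 D, val ≤ ∫ θ in Set.Ico 0 D, ∑ a, (I a).indicator (fun _ => c a) θ :=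
    setIntegral_mono_on (integrableOn_const (by simp)) (integrable_finsetSum _ fun a _ => hint a)
      measurableSet_Ico hpt
  rw [integral_finsetSum _ fun a _ => hint a] at h3
  have h4 : ∫ _ in Set.Ico 0 D, val = val * D := by
    simp [hD, mul_comm]
  rw [h4] at h3
  refine h3.trans (Finset.sum_le_sum fun a _ => ?_)
  rw [integral_indicator (hIm a), Measure.restrict_restrict (hIm a), setIntegral_const, smul_eq_mul,
    mul_comm]
  refine mul_le_mul_of_nonneg_left ?_ (hc a)
  by_cases hab : a = b
  · simp [I, hab, hl]
  · have h5 : volume.real (I a ∩ Set.Ico 0 D) ≤ volume.real (Set.Ico (d (tl a)) (d (hd a))) := by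
      refine measureReal_mono ?_ (by simp)
      simp [I, hab]
    refine h5.trans ?_
    rw [Measure.real, Real.volume_Ico, ENNReal.toReal_ofReal']
    exact max_le (by linarith [h2 a hab]) (hl a)

lemma aux_dual [Fintype A] [DecidableEq A] (F : Finset (List A)) (hF : F.Nonempty)
    (c : A → ℝ) (hc : ∀ a, 0 ≤ c a) (val : ℝ) (hval : 0 < val) (hnd : ∀ P ∈ F, P.Nodup)
    (hno : ∀ (l : A → ℝ) (D : ℝ), (∀ a, 0 ≤ l a) → 0 ≤ D → (∀ P ∈ F, D ≤ (P.map l).sum) →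
      val * D ≤ ∑ a, c a * l a) :
    ∃ y : List A → ℝ, (∀ P, 0 ≤ y P) ∧ (∀ P, P ∉ F → y P = 0) ∧ ∑ P ∈ F, y P = val ∧
      ∀ a, ∑ P ∈ F with a ∈ P, y P ≤ c a := by
  classical
  let g : {P // P ∈ F} → A → ℝ := fun P a => if a ∈ P.1 then val else 0
  let K : Set (A → ℝ) := (Fintype.linearCombination ℝ g) '' (stdSimplex ℝ {P // P ∈ F})
  let T : Set (A → ℝ) := Set.Iic c
  by_cases hdis : Disjoint K T
  · exfalso
    obtain ⟨f, α, β, h1, h2, h3⟩ := geometric_hahn_banach_compact_closed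
      ((convex_stdSimplex ℝ {P // P ∈ F}).linear_image (Fintype.linearCombination ℝ g))
      ((isCompact_stdSimplex ℝ {P // P ∈ F}).image (LinearMap.continuous_of_finiteDimensional _)) (convex_Iic c) isClosed_Iic hdis
    have hf : ∀ w : A → ℝ, f w = ∑ a, w a * f (Pi.single a 1) := by
      intro w
      conv_lhs => rw [pi_eq_sum_univ' w]
      simp [map_sum]
    let l : A → ℝ := fun a => - f (Pi.single a 1)
    have hl : ∀ a, 0 ≤ l a := by
      intro a
      by_contra hneg
      push Not at hneg
      obtain ⟨n, hn⟩ := exists_nat_gt ((f c - β) / (-l a))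
      have h4 := h3 (c - (n : ℝ) • Pi.single a 1) (by
        intro e
        by_cases h : e = a
        · subst h; simp
        · simp [h])
      rw [div_lt_iff₀ (by linarith)] at hn
      simp only [map_sub, map_smul, smul_eq_mul] at h4
      simp only [l] at hn
      linarith
    have hfc : ∑ a, c a * l a = - f c := by
      rw [hf c]; simp [l]
    have hcb := h3 c (Set.mem_Iic.2 le_rfl)
    have hpos : 0 ≤ ∑ a, c a * l a := Finset.sum_nonneg fun a _ => mul_nonneg (hc a) (hl a)
    have := hno l (-α / val) hl (div_nonneg (by linarith) hval.le) ?_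
    · rw [mul_div_cancel₀ _ hval.ne'] at this
      linarith
    · intro P hP
      have h5 := h1 (g ⟨P, hP⟩) ⟨Pi.single ⟨P, hP⟩ 1, single_mem_stdSimplex ℝ _, by
        simp⟩
      rw [div_le_iff₀ hval]
      have h6 : f (g ⟨P, hP⟩) = - ((P.map l).sum * val) := by
        rw [hf, ← List.sum_toFinset _ (hnd P hP), Finset.sum_mul, ← Finset.sum_neg_distrib]
        simp only [g, ite_mul, zero_mul, l, neg_mul, neg_neg]
        rw [← Finset.sum_filter]
        refine Finset.sum_congr (by ext; simp) fun a _ => by ring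
      linarith
  · obtain ⟨_, ⟨y, hy, rfl⟩, hwT⟩ := Set.not_disjoint_iff.1 hdis
    refine ⟨fun P => if h : P ∈ F then val * y ⟨P, h⟩ else 0, ?_, ?_, ?_, ?_⟩
    · intro P
      dsimp only
      split_ifs with h
      · exact mul_nonneg hval.le (hy.1 _)
      · exact le_rfl
    · intro P h; simp [h]
    · rw [← Finset.sum_coe_sort]
      have h2 : ∑ i ∈ F.attach, y i = 1 := hy.2
      simp [← Finset.mul_sum, h2]
    · intro a
      have h1 := hwT a
      refine le_trans (le_of_eq ?_) h1
      rw [Finset.sum_filter, ← Finset.sum_coe_sort]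
      simp [Fintype.linearCombination_apply, g, mul_comm]

lemma aux_sumOver {x : List A → ℝ} {S : Set (List A)} (hS : S.Finite) :
    sumOver x S = ∑ P ∈ hS.toFinset, x P := by
  rw [sumOver, finsum_mem_eq_finite_toFinset_sum _ hS]

lemma aux_sumOver_half {x : List A → ℝ} {S : Set (List A)} (hS : S.Finite) :
    sumOver (fun P => x P / 2) S = sumOver x S / 2 := by
  rw [aux_sumOver hS, aux_sumOver hS, Finset.sum_div]

/-- If for each arc `a`, `C a` is a minimum-capacity `tl a`-`t`-cut containing
`a`, and `u'(a) := min (u a) (u (C a ∖ {a}))`, then for every s-t-flow `x'` with respect to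
the capacities `u'`, the flow `x := (1/2)·x'` is a strictly reroutable s-t-flow w.r.t. `u`. -/
theorem half_of_flow_wrt_reduced_capacities_is_strictlyReroutable
    {V A : Type} [Fintype V] [DecidableEq V] [Fintype A] [DecidableEq A]
    (tl hd : A → V) (s t : V) (u : A → ℝ) (hu : ∀ a, 0 ≤ u a)
    (hcover : ∀ v : V, ∃ L : List A, IsPath tl hd s t L ∧ v ∈ s :: L.map hd)
    (C : A → Finset A)
    (hC : ∀ a : A, a ∈ C a ∧ IsCut tl hd (tl a) t (C a) ∧
      ∀ C' : Finset A, a ∈ C' → IsCut tl hd (tl a) t C' →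
        ∑ e ∈ C a, u e ≤ ∑ e ∈ C', u e)
    (x' : List A → ℝ)
    (hx' : IsFlow tl hd s t (fun a => min (u a) (∑ e ∈ (C a).erase a, u e)) x') :
    IsFlow tl hd s t u (fun P => x' P / 2) ∧
      StrictlyReroutable tl hd s t u (fun P => x' P / 2) := by
  classical
  have hfin : ∀ a, {P | IsPath tl hd s t P ∧ a ∈ P}.Finite := fun a =>
    (aux_paths_finite tl hd s t).subset fun P hP => hP.1
  obtain ⟨hx0, hxp, hxc⟩ := hx'
  have hhalf : ∀ a, arcFlow tl hd s t (fun P => x' P / 2) a = arcFlow tl hd s t x' a / 2 :=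
    fun a => aux_sumOver_half (hfin a)
  have hnn : ∀ a, 0 ≤ arcFlow tl hd s t x' a := fun a => by
    rw [arcFlow, aux_sumOver (hfin a)]
    exact Finset.sum_nonneg fun P _ => hx0 P
  have hle : ∀ a, arcFlow tl hd s t x' a ≤ u a := fun a => (hxc a).trans (min_le_left _ _)
  refine ⟨⟨fun P => div_nonneg (hx0 P) (by norm_num), fun P hP => by simp [hxp P hP],
    fun a => by rw [hhalf]; linarith [hnn a, hle a]⟩, ?_⟩
  intro b
  have hfinQ : {Q | IsPath tl hd (tl b) t Q ∧ b ∉ Q}.Finite :=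
    (aux_paths_finite tl hd (tl b) t).subset fun P hP => hP.1
  have hfinQa : ∀ a, {Q | IsPath tl hd (tl b) t Q ∧ b ∉ Q ∧ a ∈ Q}.Finite := fun a =>
    (aux_paths_finite tl hd (tl b) t).subset fun P hP => hP.1
  by_cases hval : 0 < arcFlow tl hd s t x' b / 2
  swap
  · have h0 : arcFlow tl hd s t x' b = 0 := by linarith [hnn b]
    refine ⟨fun _ => 0, fun _ => le_rfl, fun _ _ => rfl, fun a _ => ?_, ?_⟩
    · rw [hhalf, reArcFlow, aux_sumOver (hfinQa a)]
      simp only [Finset.sum_const_zero]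
      linarith [hnn a, hle a]
    · rw [hhalf, reVal, aux_sumOver hfinQ, h0]; simp
  let c : A → ℝ := fun a => u a - arcFlow tl hd s t x' a / 2
  have hc2 : ∀ a, u a / 2 ≤ c a := fun a => by simp only [c]; linarith [hle a]
  have hc0 : ∀ a, 0 ≤ c a := fun a => by linarith [hc2 a, hu a]
  have hcut : ∀ S : Finset A, (∀ P, IsPath tl hd (tl b) t P → b ∉ P → ∃ a ∈ S, a ∈ P) →
      arcFlow tl hd s t x' b / 2 ≤ ∑ a ∈ S, c a := by
    intro S hS
    obtain ⟨hb, -, hmin⟩ := hC b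
    have h1 := hmin (insert b (S.erase b)) (by simp) (by
      intro P hP
      by_cases hbP : b ∈ P
      · exact ⟨b, by simp, hbP⟩
      · obtain ⟨a, ha, haP⟩ := hS P hP hbP
        exact ⟨a, by simp [ha, em], haP⟩)
    rw [Finset.sum_insert (by simp), ← Finset.add_sum_erase _ _ hb] at h1
    have h2 := (hxc b).trans (min_le_right _ _)
    have h3 : ∑ a ∈ S.erase b, u a ≤ ∑ a ∈ S, u a :=
      Finset.sum_le_sum_of_subset_of_nonneg (Finset.erase_subset _ _) fun a _ _ => hu a
    have h4 : ∑ a ∈ S, u a / 2 ≤ ∑ a ∈ S, c a := Finset.sum_le_sum fun a _ => hc2 a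
    rw [← Finset.sum_div] at h4
    linarith
  have hne : hfinQ.toFinset.Nonempty := by
    by_contra hemp
    rw [Finset.not_nonempty_iff_eq_empty, Set.Finite.toFinset_eq_empty] at hemp
    have := hcut ∅ (fun P hP hb => by
      have : P ∈ {Q | IsPath tl hd (tl b) t Q ∧ b ∉ Q} := ⟨hP, hb⟩
      rw [hemp] at this
      exact this.elim)
    simp at this
    linarith
  obtain ⟨y, hy0, hyF, hyv, hyc⟩ := aux_dual hfinQ.toFinset hne c hc0 _ hval
    (fun P hP => by
      rw [Set.Finite.mem_toFinset] at hP
      exact List.Nodup.of_map hd (List.nodup_cons.1 hP.1.2).2)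
    (fun l D hl hD hP => aux_round tl hd (tl b) t b l c hl hc0 D _ hD
      (fun P h1 h2 => hP P (by rw [Set.Finite.mem_toFinset]; exact ⟨h1, h2⟩)) hcut)
  refine ⟨y, hy0, fun Q hQ => hyF Q (by rw [Set.Finite.mem_toFinset]; exact hQ), fun a _ => ?_, ?_⟩
  · rw [hhalf, reArcFlow, aux_sumOver (hfinQa a)]
    refine le_trans (le_of_eq ?_) (hyc a)
    refine Finset.sum_congr ?_ fun _ _ => rfl
    ext Q
    simp [and_assoc]
  · rw [hhalf, reVal, aux_sumOver hfinQ, hyv]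
end

section
/- Let x be a reroutable s-t-flow in a unit-capacity network (u ≡ 1) and let C ∈ 𝒞 be a t-separating cut. If ∑_{a∈C} (1 − x(a)) < 1, then C is x-bad. -/
open scoped BigOperators

variable {V A : Type}

/-- `δ⁺(S)`: the set of arcs with tail in `S` and head outside `S`. -/
def outCut [Fintype A] [DecidableEq V] (tl hd : A → V) (S : Finset V) : Finset A :=
  Finset.univ.filter fun a => tl a ∈ S ∧ hd a ∉ S

/-- Arc `b ∈ C` is `(x, C)`-bad: some flow-carrying path traverses `b` before some arc of `C`. -/
def ArcBad (tl hd : A → V) (s t : V) (x : List A → ℝ) (C : Finset A) (b : A) : Prop :=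
  ∃ a ∈ C, ∃ P : List A, IsPath tl hd s t P ∧ Before P b a ∧ 0 < x P

/-- The cut `C` is `x`-bad: every arc of `C` is `(x, C)`-bad. -/
def CutBad (tl hd : A → V) (s t : V) (x : List A → ℝ) (C : Finset A) : Prop :=
  ∀ b ∈ C, ArcBad tl hd s t x C b

theorem finite_nodupLists {A : Type} [Fintype A] : {P : List A | P.Nodup}.Finite := by
  refine (List.finite_length_le A (Fintype.card A)).subset ?_
  intro P hP
  exact List.Nodup.length_le_card hP

theorem IsPath.nodup_arcs {V A : Type} {tl hd : A → V} {v w : V} {P : List A}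
    (h : IsPath tl hd v w P) : P.Nodup :=
  List.Nodup.of_map hd (List.nodup_cons.1 h.2).2

theorem sumOver_eq_s8 {A : Type} [Fintype A] (x : List A → ℝ) (S : Set (List A))
    (hS : ∀ P ∈ S, P.Nodup) :
    sumOver x S = ∑ P ∈ (finite_nodupLists (A := A)).toFinset, S.indicator x P := by
  unfold sumOver
  rw [finsum_mem_def]
  apply finsum_eq_sum_of_support_subset
  intro P hP
  have : P ∈ S := Set.mem_of_indicator_ne_zero hP
  simpa using hS P this

theorem walk_crosses {V A : Type} [Fintype A] [DecidableEq V] (tl hd : A → V) (t : V)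
    (S : Finset V) (htS : t ∉ S) : ∀ (Q : List A) (v : V), v ∈ S → IsWalk tl hd v t Q →
    ∃ a ∈ Q, a ∈ outCut tl hd S := by
  intro Q
  induction Q with
  | nil => intro v hv h; exact absurd (h ▸ hv) htS
  | cons a L ih =>
    intro v hv h
    obtain ⟨h1, h2⟩ := h
    by_cases hh : hd a ∈ S
    · obtain ⟨c, hc, hc'⟩ := ih _ hh h2
      exact ⟨c, List.mem_cons_of_mem _ hc, hc'⟩
    · exact ⟨a, List.mem_cons_self, by simp [outCut, hh, h1, hv]⟩

/-- In a unit-capacity network, if `x` is reroutable and a t-separating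
cut `C = δ⁺(S)` satisfies `∑_{a ∈ C} (1 - x(a)) < 1`, then `C` is `x`-bad. -/
theorem cut_with_small_slack_is_bad
    {V A : Type} [Fintype V] [DecidableEq V] [Fintype A] [DecidableEq A]
    (tl hd : A → V) (s t : V)
    (hδ : ∀ S : Finset V, S.Nonempty → t ∉ S → (outCut tl hd S).Nonempty)
    (x : List A → ℝ) (hx : IsFlow tl hd s t (fun _ => (1 : ℝ)) x)
    (hrf : Reroutable tl hd s t (fun _ => (1 : ℝ)) x)
    (S : Finset V) (hS : S.Nonempty) (htS : t ∉ S)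
    (hslack : ∑ a ∈ outCut tl hd S, (1 - arcFlow tl hd s t x a) < 1) :
    CutBad tl hd s t x (outCut tl hd S) := by
  intro b hb
  by_contra hbad
  obtain ⟨y, hy0, hyP, hycap, hyval⟩ := hrf b
  have htb : tl b ∈ S := by
    have := hb
    simp only [outCut, Finset.mem_filter] at this
    exact this.2.1
  have h1 : reVal tl hd t b y ≤
      ∑ a ∈ (outCut tl hd S).erase b, reArcFlow tl hd t b y a := by
    unfold reVal reArcFlow
    rw [sumOver_eq_s8 _ _ (fun P hP => hP.1.nodup_arcs),
      Finset.sum_congr rfl (fun a _ => sumOver_eq_s8 y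
        {Q | IsPath tl hd (tl b) t Q ∧ b ∉ Q ∧ a ∈ Q} (fun P hP => hP.1.nodup_arcs)),
      Finset.sum_comm]
    refine Finset.sum_le_sum fun Q _ => ?_
    have hnn : ∀ a ∈ (outCut tl hd S).erase b,
        0 ≤ Set.indicator {Q | IsPath tl hd (tl b) t Q ∧ b ∉ Q ∧ a ∈ Q} y Q :=
      fun a _ => Set.indicator_nonneg (fun P _ => hy0 P) Q
    by_cases hQ : IsPath tl hd (tl b) t Q ∧ b ∉ Q
    · obtain ⟨c, hcQ, hcC⟩ := walk_crosses tl hd t S htS Q _ htb hQ.1.1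
      have hcb : c ≠ b := fun h => hQ.2 (h ▸ hcQ)
      have h := Finset.single_le_sum hnn (Finset.mem_erase.2 ⟨hcb, hcC⟩)
      rw [Set.indicator_of_mem (show Q ∈ {Q | IsPath tl hd (tl b) t Q ∧ b ∉ Q ∧ c ∈ Q} from
        ⟨hQ.1, hQ.2, hcQ⟩)] at h
      rw [Set.indicator_of_mem (show Q ∈ {Q | IsPath tl hd (tl b) t Q ∧ b ∉ Q} from hQ)]
      exact h
    · rw [Set.indicator_of_notMem (show Q ∉ {Q | IsPath tl hd (tl b) t Q ∧ b ∉ Q} from hQ)]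
      exact Finset.sum_nonneg hnn
  have h2 : ∀ a ∈ outCut tl hd S,
      availCap tl hd s t (fun _ => (1 : ℝ)) x b a = 1 - arcFlow tl hd s t x a := by
    intro a ha
    unfold availCap arcFlow
    congr 1
    rw [sumOver_eq_s8 _ _ (fun P hP => hP.1.nodup_arcs),
      sumOver_eq_s8 _ _ (fun P hP => hP.1.nodup_arcs)]
    refine Finset.sum_congr rfl fun P _ => ?_
    by_cases hB : IsPath tl hd s t P ∧ Before P b a
    · have h0 : x P = 0 := by
        by_contra hne
        exact hbad ⟨a, ha, P, hB.1, hB.2, lt_of_le_of_ne (hx.1 P) (Ne.symm hne)⟩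
      simp [Set.indicator, h0]
    · have hiff : P ∈ {P | IsPath tl hd s t P ∧ a ∈ P ∧ ¬ Before P b a} ↔
          P ∈ {P | IsPath tl hd s t P ∧ a ∈ P} := by
        change (IsPath tl hd s t P ∧ a ∈ P ∧ ¬ Before P b a) ↔ (IsPath tl hd s t P ∧ a ∈ P)
        tauto
      by_cases hm : P ∈ {P | IsPath tl hd s t P ∧ a ∈ P}
      · rw [Set.indicator_of_mem hm, Set.indicator_of_mem (hiff.2 hm)]
      · rw [Set.indicator_of_notMem hm, Set.indicator_of_notMem (fun h => hm (hiff.1 h))]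
  have h3 : ∑ a ∈ (outCut tl hd S).erase b, reArcFlow tl hd t b y a ≤
      ∑ a ∈ (outCut tl hd S).erase b, (1 - arcFlow tl hd s t x a) := by
    refine Finset.sum_le_sum fun a ha => ?_
    rw [← h2 a (Finset.mem_of_mem_erase ha)]
    exact hycap a (Finset.ne_of_mem_erase ha)
  have h4 := Finset.add_sum_erase (outCut tl hd S) (fun a => 1 - arcFlow tl hd s t x a) hb
  linarith
end

section
/- Let x be an s-t-flow and let S, S' ⊆ V∖{t} be nonempty sets such that the t-separating cuts δ⁺(S) and δ⁺(S') are both x-bad. Then δ⁺(S ∪ S') is an x-bad t-separating cut as well. -/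
open scoped BigOperators

variable {V A : Type}

theorem walk_exit {V A : Type} (tl hd : A → V) (U : Finset V) (w : V) (hw : w ∉ U) :
    ∀ (L : List A) (v : V), IsWalk tl hd v w L → v ∈ U →
      ∃ l₁ c l₂, L = l₁ ++ c :: l₂ ∧ tl c ∈ U ∧ hd c ∉ U
  | [], v, h, hv => absurd (h ▸ hv) hw
  | a :: L, v, h, hv => by
    obtain ⟨h1, h2⟩ := h
    by_cases ha : hd a ∈ U
    · obtain ⟨l₁, c, l₂, rfl, hc⟩ := walk_exit tl hd U w hw L (hd a) h2 ha
      exact ⟨a :: l₁, c, l₂, rfl, hc⟩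
    · exact ⟨[], a, L, rfl, h1 ▸ hv, ha⟩

theorem walk_suffix {V A : Type} (tl hd : A → V) (w : V) (a : A) (M : List A) :
    ∀ (L : List A) (v : V), IsWalk tl hd v w (L ++ a :: M) → IsWalk tl hd (tl a) w (a :: M)
  | [], _, h => ⟨rfl, h.2⟩
  | _ :: L, _, h => walk_suffix tl hd w a M L _ h.2

theorem arcBad_mono {V A : Type} [DecidableEq V] [Fintype A]
    (tl hd : A → V) (s t : V) (x : List A → ℝ) (S U : Finset V) (hSU : S ⊆ U) (ht : t ∉ U)
    (b : A) (h : ArcBad tl hd s t x (outCut tl hd S) b) :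
    ArcBad tl hd s t x (outCut tl hd U) b := by
  obtain ⟨a, ha, P, hP, ⟨l₁, l₂, l₃, rfl⟩, hx⟩ := h
  simp only [outCut, Finset.mem_filter, Finset.mem_univ, true_and] at ha
  have hw : IsWalk tl hd (tl a) t (a :: l₃) :=
    walk_suffix tl hd t a l₃ (l₁ ++ b :: l₂) s (by simpa using hP.1)
  obtain ⟨m₁, c, m₂, he, hc⟩ := walk_exit tl hd U t ht _ _ hw (hSU ha.1)
  exact ⟨c, by simpa [outCut] using hc, _, hP, ⟨l₁, l₂ ++ m₁, m₂, by simp [he]⟩, hx⟩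

/-- If `δ⁺(S)` and `δ⁺(S')` are both `x`-bad t-separating cuts, then
`δ⁺(S ∪ S')` is an `x`-bad t-separating cut as well. -/
theorem badCut_union
    {V A : Type} [Fintype V] [DecidableEq V] [Fintype A] [DecidableEq A]
    (tl hd : A → V) (s t : V) (u : A → ℝ) (hu : ∀ a, 0 ≤ u a)
    (x : List A → ℝ) (hx : IsFlow tl hd s t u x)
    (S S' : Finset V) (hS : S.Nonempty) (hS' : S'.Nonempty)
    (htS : t ∉ S) (htS' : t ∉ S')
    (hbad : CutBad tl hd s t x (outCut tl hd S))
    (hbad' : CutBad tl hd s t x (outCut tl hd S')) :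
    (S ∪ S').Nonempty ∧ t ∉ S ∪ S' ∧ CutBad tl hd s t x (outCut tl hd (S ∪ S')) := by
  have ht : t ∉ S ∪ S' := by simp [htS, htS']
  refine ⟨hS.mono Finset.subset_union_left, ht, fun b hb => ?_⟩
  simp only [outCut, Finset.mem_filter, Finset.mem_univ, true_and, Finset.mem_union,
    not_or] at hb
  obtain ⟨h1 | h1, h2, h3⟩ := hb
  · exact arcBad_mono tl hd s t x S _ Finset.subset_union_left ht b
      (hbad b (by simp [outCut, h1, h2]))
  · exact arcBad_mono tl hd s t x S' _ Finset.subset_union_right ht b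
      (hbad' b (by simp [outCut, h1, h3]))
end
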